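/- Let m ≥ 1 and let α₁,…,α_m be distinct algebraic numbers such that G(X) := ∏_{j=1}^m (X − αⱼ) ∈ ℤ[X]. Let q, p₀,…,p_{m−1} be integers with gcd(q, p₀,…,p_{m−1}) = 1, and set βⱼ := Σ_{i=0}^{m−1} (pᵢ/q)·αⱼ^i for j = 1,…,m. Then log max(|q|, |p₀|,…,|p_{m−1}|) ≤ 2m² + (m−1)·h(G) + Σ_{j=1}^m h(βⱼ). -/

import Mathlib

open scoped BigOperators Classical NumberField

open NumberField IsDedekindDomain

noncomputable section

/-- The order of vanishing `ord_v(x) ∈ ℤ` of `x ∈ L` at a finite place (nonzero prime) `v`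
of the ring of integers of `L`, with the convention `ord_v(0) = 0`. -/
noncomputable def ordAt {L : Type*} [Field L] [NumberField L]
    (v : HeightOneSpectrum (𝓞 L)) (x : L) : ℤ :=
  if hx : x = 0 then 0
  else -Multiplicative.toAdd (WithZero.unzero
    ((Valuation.ne_zero_iff (v.valuation (K := L))).mpr hx))

/-- The absolute logarithmic Weil height of an element of a number field `L`:
`h(x) = (1/[L:ℚ]) ( ∑_{w | ∞} mult(w) log⁺ w(x) + ∑_{v fin} max(0, -ord_v x) log N(v) )`. -/
noncomputable def wHeight {L : Type*} [Field L] [NumberField L] (x : L) : ℝ :=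
  ((∑ w : InfinitePlace L, (w.mult : ℝ) * Real.log (max 1 (w x))) +
    ∑ᶠ v : HeightOneSpectrum (𝓞 L),
      ((max 0 (-(ordAt v x)) : ℤ) : ℝ) * Real.log (Ideal.absNorm v.asIdeal)) /
    (Module.finrank ℚ L)

theorem posLog_finitePlace_mk {L : Type*} [Field L] [NumberField L]
    (v : HeightOneSpectrum (𝓞 L)) (x : L) :
    Real.posLog (FinitePlace.mk v x) =
      ((max 0 (-(ordAt v x)) : ℤ) : ℝ) * Real.log (Ideal.absNorm v.asIdeal) := by
  by_cases hx : x = 0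
  · simp [hx, ordAt]
  have hN : 0 ≤ Real.log (Ideal.absNorm v.asIdeal) := Real.log_natCast_nonneg _
  have h : FinitePlace.mk v x = (Ideal.absNorm v.asIdeal : ℝ) ^ (-(ordAt v x)) := by
    rw [FinitePlace.mk_apply, FinitePlace.norm_embedding',
      WithZeroMulInt.toNNReal_neg_apply _ ((v.valuation L).ne_zero_iff.mpr hx)]
    simp [ordAt, hx]
  rw [h]
  change max 0 (Real.log _) = _
  rw [Real.log_zpow]
  push_cast
  rw [max_mul_of_nonneg _ _ hN, zero_mul]

open Height in
theorem logHeight₁_eq_finrank_mul_wHeight {L : Type*} [Field L] [NumberField L] (x : L) :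
    logHeight₁ x = Module.finrank ℚ L * wHeight x := by
  have hd : (Module.finrank ℚ L : ℝ) ≠ 0 := by
    exact_mod_cast (Module.finrank_pos (R := ℚ) (M := L)).ne'
  rw [wHeight, mul_div_cancel₀ _ hd, NumberField.logHeight₁_eq,
    ← finsum_comp_equiv FinitePlace.equivHeightOneSpectrum.symm]
  congr 1
  · simp [Real.posLog_eq_log_max_one]
  · exact finsum_congr fun v ↦ posLog_finitePlace_mk v x

theorem AbsoluteValue.det_le_factorial_mul_prod {K n : Type*} [Field K] [Fintype n]
    [DecidableEq n] (v : AbsoluteValue K ℝ) (A : Matrix n n K) (r : n → ℝ)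
    (h : ∀ i j, v (A i j) ≤ r i) :
    v A.det ≤ (Fintype.card n).factorial * ∏ i, r i := by
  rw [Matrix.det_apply]
  refine (v.sum_le _ _).trans ?_
  rw [← Fintype.card_perm, ← nsmul_eq_mul]
  refine Finset.sum_le_card_nsmul _ _ _ fun σ _ ↦ ?_
  rw [← Equiv.prod_comp σ r, Units.smul_def, zsmul_eq_mul, map_mul, map_prod]
  rw [v.map_units_intCast, one_mul]
  exact Finset.prod_le_prod (fun _ _ ↦ v.nonneg _) fun i _ ↦ h _ _

theorem IsNonarchimedean.det_le_prod {K n : Type*} [Field K] [Fintype n] [DecidableEq n]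
    {v : AbsoluteValue K ℝ} (hv : IsNonarchimedean v) (A : Matrix n n K) (r : n → ℝ)
    (h : ∀ i j, v (A i j) ≤ r i) : v A.det ≤ ∏ i, r i := by
  rw [Matrix.det_apply]
  refine hv.apply_sum_univ_le.trans (ciSup_le fun σ ↦ ?_)
  rw [← Equiv.prod_comp σ r, Units.smul_def, zsmul_eq_mul, map_mul, map_prod]
  rw [v.map_units_intCast, one_mul]
  exact Finset.prod_le_prod (fun _ _ ↦ v.nonneg _) fun i _ ↦ h _ _

theorem AbsoluteValue.vandermonde_le {K : Type*} [Field K] {m : ℕ} (v : AbsoluteValue K ℝ)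
    (α : Fin m → K) (i j : Fin m) :
    v (Matrix.vandermonde α i j) ≤ max 1 (v (α i)) ^ (m - 1) := by
  rw [Matrix.vandermonde_apply, map_pow]
  calc v (α i) ^ (j : ℕ) ≤ max 1 (v (α i)) ^ (j : ℕ) :=
        pow_le_pow_left₀ (v.nonneg _) (le_max_right _ _) _
    _ ≤ _ := pow_le_pow_right₀ (le_max_left _ _) (by omega)

theorem AbsoluteValue.vandermonde_updateCol_le {K : Type*} [Field K] {m : ℕ}
    (v : AbsoluteValue K ℝ) (α β : Fin m → K) (k i j : Fin m) :
    v ((Matrix.vandermonde α).updateCol k β i j) ≤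
      max 1 (v (α i)) ^ (m - 1) * max (v (β i)) 1 := by
  have h1 : 1 ≤ max 1 (v (α i)) ^ (m - 1) := one_le_pow₀ (le_max_left _ _)
  rw [Matrix.updateCol_apply]
  split_ifs
  · exact (le_max_left _ _).trans (le_mul_of_one_le_left (by positivity) h1)
  · exact (v.vandermonde_le α i j).trans (le_mul_of_one_le_right (by positivity) (le_max_right _ _))

theorem Matrix.cramer_mulVec_self {R n : Type*} [CommRing R] [Fintype n] [DecidableEq n]
    (A : Matrix n n R) (x : n → R) : A.cramer (A.mulVec x) = A.det • x := by
  rw [Matrix.cramer_eq_adjugate_mulVec, Matrix.mulVec_mulVec, Matrix.adjugate_mul,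
    Matrix.smul_mulVec, Matrix.one_mulVec]

/-- For a nonarchimedean absolute value, a bound on all multiples `c * n` by members of a coprime
family of integers is a bound on `c`. -/
theorem IsNonarchimedean.le_of_forall_mul_le {K ι : Type*} [Field K] {v : AbsoluteValue K ℝ}
    (hv : IsNonarchimedean v) {c : K} {B : ℝ} {x : ι → ℤ}
    (hx : ∀ k : ℤ, (∀ i, k ∣ x i) → IsUnit k) (hB : 0 ≤ B)
    (h : ∀ i, v (c * x i) ≤ B) : v c ≤ B := by
  let I : Ideal ℤ :=
    { carrier := {n | v (c * n) ≤ B}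
      zero_mem' := by simpa using hB
      add_mem' := fun {a b} ha hb ↦ by
        simp only [Set.mem_ofPred_eq, Int.cast_add, mul_add] at *
        exact (hv _ _).trans (max_le ha hb)
      smul_mem' := fun a b hb ↦ by
        simp only [Set.mem_ofPred_eq, smul_eq_mul, Int.cast_mul] at *
        rw [mul_left_comm, map_mul]
        exact (mul_le_of_le_one_left (v.nonneg _) hv.apply_intCast_le_one).trans hb }
  have hgen : IsUnit (Submodule.IsPrincipal.generator I) :=
    hx _ fun i ↦ (Submodule.IsPrincipal.mem_iff_generator_dvd I).mp (h i)
  have h1 : (1 : ℤ) ∈ I :=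
    (Submodule.IsPrincipal.mem_iff_generator_dvd I).mpr (hgen.dvd)
  have h2 : v (c * ((1 : ℤ) : K)) ≤ B := h1
  simpa using h2

theorem Polynomial.prod_max_one_norm_le_of_map_eq_prod {m : ℕ} (G : Polynomial ℤ) (z : Fin m → ℂ)
    (hG : G.map (Int.castRingHom ℂ) = ∏ j, (Polynomial.X - Polynomial.C (z j))) :
    ∏ j, max 1 ‖z j‖ ≤ ((m : ℝ) + 1) * ((G.support.sup fun i ↦ (G.coeff i).natAbs : ℕ) : ℝ) := by
  set p := G.map (Int.castRingHom ℂ) with hp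
  have hinj : Function.Injective (Int.castRingHom ℂ) := Int.cast_injective
  have hroots : p.roots = Finset.univ.val.map z := by
    rw [hG]
    have := Polynomial.roots_multiset_prod_X_sub_C (Finset.univ.val.map z)
    rwa [Multiset.map_map] at this
  have hmonic : p.Monic := hG ▸ Polynomial.monic_prod_X_sub_C z Finset.univ
  have hdeg : p.natDegree = m := by
    rw [hG, Polynomial.natDegree_finsetProd_X_sub_C_eq_card]
    simp
  calc ∏ j, max 1 ‖z j‖ = p.mahlerMeasure := by
        rw [Polynomial.mahlerMeasure_eq_leadingCoeff_mul_prod_roots, hmonic.leadingCoeff, hroots,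
          Multiset.map_map, norm_one, one_mul]
        rfl
    _ ≤ p.sum fun _ a ↦ ‖a‖ := p.mahlerMeasure_le_sum_norm_coeff
    _ ≤ p.support.card • ((G.support.sup fun i ↦ (G.coeff i).natAbs : ℕ) : ℝ) := by
        refine Finset.sum_le_card_nsmul _ _ _ fun i hi ↦ ?_
        rw [hp, Polynomial.support_map_of_injective _ hinj] at hi
        have := Finset.le_sup (f := fun i ↦ (G.coeff i).natAbs) hi
        beta_reduce
        rw [hp, Polynomial.coeff_map, eq_intCast, Complex.norm_intCast, ← Int.cast_abs,
          Int.abs_eq_natAbs]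
        exact_mod_cast this
    _ ≤ _ := by
        rw [nsmul_eq_mul]
        gcongr
        have := Polynomial.card_supp_le_succ_natDegree p
        rw [hdeg] at this
        exact_mod_cast this

theorem log_factorial_add_mul_log_le {m : ℕ} (hm : 1 ≤ m) :
    Real.log m.factorial + ((m : ℝ) - 1) * Real.log (m + 1) ≤ 2 * (m : ℝ) ^ 2 := by
  have hm' : (1 : ℝ) ≤ m := by exact_mod_cast hm
  have h1 : Real.log m.factorial ≤ m * Real.log m := by
    rw [← Real.log_pow]
    exact Real.log_le_log (by positivity) (by exact_mod_cast Nat.factorial_le_pow m)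
  have h2 : Real.log m ≤ m := (Real.log_le_sub_one_of_pos (by linarith)).trans (by linarith)
  have h3 : Real.log ((m : ℝ) + 1) ≤ m :=
    (Real.log_le_sub_one_of_pos (by linarith)).trans (by linarith)
  nlinarith

theorem natAbs_max_sup_le {m : ℕ} {q : ℤ} {p : ℕ → ℤ} {B : ℝ} (hB : 0 ≤ B)
    (hq : |(q : ℝ)| ≤ B) (hp : ∀ i < m, |(p i : ℝ)| ≤ B) :
    ((max q.natAbs ((Finset.range m).sup fun i => (p i).natAbs) : ℕ) : ℝ) ≤ B := by
  rw [← Nat.le_floor_iff hB]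
  refine max_le (Nat.le_floor ?_) (Finset.sup_le fun i hi ↦ Nat.le_floor ?_)
  · simpa [Nat.cast_natAbs] using hq
  · simpa [Nat.cast_natAbs] using hp i (Finset.mem_range.mp hi)

/-- **Lemma 5.1** (Evertse–Győry, Lemma 5.2).  Let `α₁, …, α_m` be distinct algebraic
numbers with `G(X) = ∏ (X - αⱼ) ∈ ℤ[X]`, let `q, p₀, …, p_{m-1}` be coprime integers with
`q ≠ 0`, and put `βⱼ = ∑ᵢ (pᵢ/q) αⱼ^i`.  Then
`log max(|q|, |p₀|, …, |p_{m-1}|) ≤ 2m² + (m-1) h(G) + ∑ⱼ h(βⱼ)`. -/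
theorem coeff_bound_from_heights
    (L : Type) [Field L] [NumberField L]
    (m : ℕ) (hm : 1 ≤ m)
    (α : Fin m → L) (hα : Function.Injective α)
    (Gz : Polynomial ℤ)
    (hG : Polynomial.map (Int.castRingHom L) Gz =
      ∏ j : Fin m, (Polynomial.X - Polynomial.C (α j)))
    (q : ℤ) (p : ℕ → ℤ) (hq : q ≠ 0)
    (hcop : ∀ k : ℤ, (∀ i, i < m → k ∣ p i) → k ∣ q → IsUnit k)
    (β : Fin m → L)
    (hβ : ∀ j, (q : L) * β j = ∑ i ∈ Finset.range m, (p i : L) * α j ^ i) :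
    Real.log ((max q.natAbs ((Finset.range m).sup fun i => (p i).natAbs) : ℕ) : ℝ) ≤
      2 * (m : ℝ) ^ 2 +
        ((m : ℝ) - 1) *
          Real.log (((Gz.support.sup fun i => (Gz.coeff i).natAbs) : ℕ) : ℝ) +
        ∑ j : Fin m, wHeight (β j) := by
  classical
  set H : ℕ := max q.natAbs ((Finset.range m).sup fun i => (p i).natAbs)
  set M : ℕ := Gz.support.sup fun i => (Gz.coeff i).natAbs
  set d := Module.finrank ℚ L
  have hd0 : (0 : ℝ) < d := by exact_mod_cast Module.finrank_pos (R := ℚ) (M := L)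
  have hqL : (q : L) ≠ 0 := Int.cast_ne_zero.mpr hq
  have hV0 : (Matrix.vandermonde α).det ≠ 0 := Matrix.det_vandermonde_ne_zero_iff.mpr hα
  set V := (Matrix.vandermonde α).det with hV
  let c : L := V / q
  have hc : c ≠ 0 := div_ne_zero hV0 hqL
  have hcq : c * q = V := div_mul_cancel₀ _ hqL
  have hcp (i : Fin m) : c * p i = ((Matrix.vandermonde α).updateCol i β).det := by
    have h1 : (Matrix.vandermonde α).mulVec (fun i ↦ (p i : L)) = (q : L) • β := by
      ext j
      simp [Matrix.mulVec, dotProduct, hβ, Finset.sum_range, mul_comm]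
    have h2 := congrFun (Matrix.cramer_mulVec_self (Matrix.vandermonde α) fun i ↦ (p i : L)) i
    rw [h1, map_smul] at h2
    simp only [Pi.smul_apply, smul_eq_mul, Matrix.cramer_apply] at h2
    rw [← mul_right_inj' hqL, h2, ← hV, ← hcq]
    ring
  have hmonic : Gz.Monic :=
    Polynomial.monic_of_injective (f := Int.castRingHom L) Int.cast_injective
      (hG ▸ Polynomial.monic_prod_X_sub_C α Finset.univ)
  let R (v : AbsoluteValue L ℝ) (j : Fin m) : ℝ :=
    max 1 (v (α j)) ^ (m - 1) * max (v (β j)) 1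
  have hVR (v : AbsoluteValue L ℝ) (i j) : v (Matrix.vandermonde α i j) ≤ R v i :=
    (v.vandermonde_le α i j).trans (le_mul_of_one_le_right (by positivity) (le_max_right _ _))
  have hM1 : 1 ≤ M := by
    have : (Gz.coeff Gz.natDegree).natAbs ≤ M :=
      Finset.le_sup (f := fun i ↦ (Gz.coeff i).natAbs)
        (Polynomial.natDegree_mem_support_of_nonzero hmonic.ne_zero)
    rwa [hmonic.coeff_natDegree, Int.natAbs_one] at this
  let C : ℝ := m.factorial * (((m : ℝ) + 1) * M) ^ (m - 1)
  have hC : 0 < C := by positivity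
  have hinf (w : InfinitePlace L) : H * w c ≤ C * ∏ j, max (w (β j)) 1 := by
    have hwc : 0 < w c := w.1.pos hc
    have hα' : ∏ j, max 1 (w (α j)) ≤ ((m : ℝ) + 1) * M := by
      have := Polynomial.prod_max_one_norm_le_of_map_eq_prod Gz (fun j ↦ w.embedding (α j)) (by
        have := congrArg (Polynomial.map w.embedding) hG
        rw [Polynomial.map_map, Polynomial.map_prod] at this
        simpa [RingHom.ext_int (w.embedding.comp (Int.castRingHom L)) (Int.castRingHom ℂ)]
          using this)
      simpa [InfinitePlace.norm_embedding_eq] using this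
    have hR : (m.factorial : ℝ) * ∏ j, R w.1 j ≤ C * ∏ j, max (w (β j)) 1 := by
      simp only [R, C, Finset.prod_mul_distrib, Finset.prod_pow, ← mul_assoc]
      gcongr ?_ * ?_ ^ _ * ?_
      · exact hα'
      · exact le_rfl
    have hbd (A : Matrix (Fin m) (Fin m) L) (hA : ∀ i j, w.1 (A i j) ≤ R w.1 i) :
        w A.det ≤ C * ∏ j, max (w (β j)) 1 := by
      have := w.1.det_le_factorial_mul_prod A _ hA
      rw [Fintype.card_fin] at this
      exact this.trans hR
    have hint (n : ℤ) : |(n : ℝ)| = w (n : L) := by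
      rw [← InfinitePlace.norm_embedding_eq, map_intCast, Complex.norm_intCast]
    rw [← le_div_iff₀ hwc]
    refine natAbs_max_sup_le (by positivity) ?_ fun i hi ↦ ?_
    · rw [le_div_iff₀ hwc, hint, ← map_mul, mul_comm, hcq]
      exact hbd _ (hVR w.1)
    · rw [le_div_iff₀ hwc, hint, ← map_mul, mul_comm, hcp ⟨i, hi⟩]
      exact hbd _ (w.1.vandermonde_updateCol_le α β _)
  have hfin (v : FinitePlace L) : v c ≤ ∏ j, max (v (β j)) 1 := by
    have hv : IsNonarchimedean v.1 := FinitePlace.add_le v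
    have hα1 (j) : v.1 (α j) ≤ 1 := by
      have hint : IsIntegral ℤ (α j) := by
        refine ⟨Gz, hmonic, ?_⟩
        rw [← Polynomial.eval_map, algebraMap_int_eq, hG, Polynomial.eval_prod]
        exact Finset.prod_eq_zero (Finset.mem_univ j) (by simp)
      have := FinitePlace.norm_le_one L v.maximalIdeal (⟨α j, hint⟩ : 𝓞 L)
      rwa [FinitePlace.norm_embedding_eq] at this
    have hR : ∏ j, R v.1 j = ∏ j, max (v (β j)) 1 :=
      Finset.prod_congr rfl fun j _ ↦ by
        simp only [R]
        rw [max_eq_left (hα1 j), one_pow, one_mul]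
        rfl
    refine hv.le_of_forall_mul_le (x := fun i : Option (Fin m) ↦ i.elim q fun i ↦ p i)
      (fun k hk ↦ hcop k (fun i hi ↦ hk (some ⟨i, hi⟩)) (hk none))
      (Finset.prod_nonneg fun _ _ ↦ by positivity) fun i ↦ ?_
    rw [← hR]
    cases i with
    | none =>
      simp only [Option.elim, hcq]
      exact hv.det_le_prod _ _ (hVR v.1)
    | some i =>
      simp only [Option.elim, hcp]
      exact hv.det_le_prod _ _ (v.1.vandermonde_updateCol_le α β _)
  have hsupp (j : Fin m) : (fun v : FinitePlace L ↦ max (v (β j)) 1).HasFiniteMulSupport := by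
    rcases eq_or_ne (β j) 0 with h | h
    · simp [h, Function.HasFiniteMulSupport]
    · have := FinitePlace.hasFiniteMulSupport h
      fun_prop
  have hprod : (H : ℝ) ^ d ≤ C ^ d * ∏ j, Height.mulHeight₁ (β j) := by
    calc (H : ℝ) ^ d
        = (∏ w : InfinitePlace L, (H * w c) ^ w.mult) * ∏ᶠ v : FinitePlace L, v c := by
          simp_rw [mul_pow]
          rw [Finset.prod_mul_distrib, Finset.prod_pow_eq_pow_sum, InfinitePlace.sum_mult_eq,
            mul_assoc, prod_abs_eq_one hc, mul_one]
      _ ≤ (∏ w : InfinitePlace L, (C * ∏ j, max (w (β j)) 1) ^ w.mult) *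
            ∏ᶠ v : FinitePlace L, ∏ j, max (v (β j)) 1 := by
          refine mul_le_mul ?_ ?_ ?_ ?_
          · exact Finset.prod_le_prod (fun w _ ↦ by positivity) fun w _ ↦
              pow_le_pow_left₀ (by positivity) (hinf w) _
          · refine finprod_le_finprod (FinitePlace.hasFiniteMulSupport hc)
              (fun v ↦ apply_nonneg v c) ?_ hfin
            fun_prop
          · exact finprod_nonneg fun v ↦ apply_nonneg v c
          · exact Finset.prod_nonneg fun w _ ↦ by positivity
      _ = _ := by
          simp_rw [mul_pow, NumberField.mulHeight₁_eq]
          rw [Finset.prod_mul_distrib, Finset.prod_pow_eq_pow_sum, InfinitePlace.sum_mult_eq,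
            finprod_prod_comm _ _ fun j _ ↦ hsupp j, Finset.prod_mul_distrib, mul_assoc]
          simp_rw [← Finset.prod_pow]
          rw [Finset.prod_comm]
  have hH0 : (0 : ℝ) < H := by
    have : 0 < H := lt_max_of_lt_left (Int.natAbs_pos.mpr hq)
    exact_mod_cast this
  have hlog := Real.log_le_log (by positivity) hprod
  rw [Real.log_pow, Real.log_mul (by positivity)
    (Finset.prod_ne_zero_iff.mpr fun j _ ↦ Height.mulHeight₁_ne_zero _), Real.log_pow,
    Real.log_prod fun j _ ↦ Height.mulHeight₁_ne_zero _] at hlog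
  simp_rw [← Height.logHeight₁_eq_log_mulHeight₁, logHeight₁_eq_finrank_mul_wHeight] at hlog
  rw [← Finset.mul_sum, ← mul_add] at hlog
  have hlog' := le_of_mul_le_mul_left hlog hd0
  have hlogC : Real.log C =
      Real.log m.factorial + ((m : ℝ) - 1) * (Real.log (m + 1) + Real.log M) := by
    have : (M : ℝ) ≠ 0 := by positivity
    simp only [C]
    rw [Real.log_mul (by positivity) (by positivity), Real.log_pow,
      Real.log_mul (by positivity) this, Nat.cast_sub hm, Nat.cast_one]
  have := log_factorial_add_mul_log_le hm
  rw [hlogC] at hlog'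
  linarith
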